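/- arXiv:1309.2172 — 3 statements merged into one kernel-verified Lean document; each statement's English description precedes it below -/
import Mathlib

section
/- Let d ≥ 3 and M ≥ 4 be integers. Then the average effective resistance of the d-dimensional toroidal grid with all side lengths equal to M satisfies R_ave(T_{M^d}) ≤ (8/(d+1))·(1 + 1/M)^{d+1} + (d/(4·M^{d−2}))·(1/3 + (d−1)·log M / π), where log denotes the natural logarithm. -/
open Real Finset

/-- Average effective resistance of the `d`-dimensional toroidal grid `T_{M^d}`
with all side lengths equal to `M`. -/
noncomputable def RaveTorus (d M : ℕ) : ℝ :=
  (1 / (M : ℝ) ^ d) * ∑ h : Fin d → Fin M,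
    if ∀ i, (h i : ℕ) = 0 then 0
    else 1 / (2 * d - 2 * ∑ i, Real.cos (2 * Real.pi * (h i : ℕ) / M))

/-- The sum of `g (l (h 0) + ⋯ + l (h (n - 1)))` over all `n`-tuples `h` of indices. -/
noncomputable def tupleSum {ι : Type*} [Fintype ι] (l : ι → ℝ) (n : ℕ) (g : ℝ → ℝ) : ℝ :=
  ∑ h : Fin n → ι, g (∑ i, l (h i))

section tupleSum

variable {ι : Type*} [Fintype ι] (l : ι → ℝ)

lemma tupleSum_zero (g : ℝ → ℝ) : tupleSum l 0 g = g 0 := by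
  simp [tupleSum]

lemma tupleSum_succ (n : ℕ) (g : ℝ → ℝ) :
    tupleSum l (n + 1) g = ∑ j, tupleSum l n (fun x => g (l j + x)) := by
  unfold tupleSum
  rw [← (Fin.consEquiv (fun _ => ι)).sum_comp, Fintype.sum_prod_type]
  simp [Fin.consEquiv, Fin.sum_univ_succ]

/-- Grouping tuples by the positions of the entries with `l = 0`. -/
lemma tupleSum_eq_sum_choose {m : ℕ} (l : Fin (m + 1) → ℝ) (hl : l 0 = 0) (d : ℕ) (g : ℝ → ℝ) :
    tupleSum l d g =
      ∑ n ∈ range (d + 1), (d.choose n : ℝ) * tupleSum (fun j : Fin m => l j.succ) n g := by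
  induction d generalizing g with
  | zero => simp [tupleSum_zero]
  | succ d ih =>
    rw [sum_choose_succ_mul (fun n _ => tupleSum (fun j : Fin m => l j.succ) n g) d,
      tupleSum_succ, Fin.sum_univ_succ, hl]
    simp only [zero_add, ih, tupleSum_succ, Finset.mul_sum]
    rw [Finset.sum_comm (s := univ)]

lemma sum_removeNth_eq (n : ℕ) (g : ℝ → ℝ) (j : Fin (n + 1)) :
    ∑ h : Fin (n + 1) → ι, g (∑ i, l (h (j.succAbove i))) = Fintype.card ι * tupleSum l n g := by
  unfold tupleSum
  rw [← (Fin.insertNthEquiv (fun _ => ι) j).sum_comp, Fintype.sum_prod_type]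
  simp [Fin.insertNthEquiv]

variable {l}

/-- Convexity of the inverse, averaged over the omission of one summand. -/
lemma succ_sq_div_le_sum_inv {n : ℕ} (hn : 0 < n) (a : Fin (n + 1) → ℝ) (ha : ∀ i, 0 < a i) :
    ((n : ℝ) + 1) ^ 2 / (n * ∑ i, a i) ≤ ∑ j, (∑ i, a (Fin.succAbove j i))⁻¹ := by
  have : NeZero n := ⟨hn.ne'⟩
  have key := sq_sum_div_le_sum_sq_div (univ : Finset (Fin (n + 1))) (fun _ => (1 : ℝ))
    (g := fun j => ∑ i, a (Fin.succAbove j i))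
    (fun j _ => sum_pos (fun i _ => ha _) univ_nonempty)
  have h : ∑ j, ∑ i, a (Fin.succAbove j i) = n * ∑ i, a i := by
    have : ∀ j, ∑ i, a (Fin.succAbove j i) = ∑ i, a i - a j := fun j => by
      rw [Fin.sum_univ_succAbove a j]; ring
    simp only [this, sum_sub_distrib, sum_const, card_univ, Fintype.card_fin, nsmul_eq_mul]
    push_cast
    ring
  simpa [h] using key

lemma succ_mul_tupleSum_inv_le (hl : ∀ j, 0 < l j) {n : ℕ} (hn : 0 < n) :
    ((n : ℝ) + 1) * tupleSum l (n + 1) (·⁻¹) ≤ n * Fintype.card ι * tupleSum l n (·⁻¹) := by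
  have h1 : ∑ h : Fin (n + 1) → ι, ((n : ℝ) + 1) ^ 2 / (n * ∑ i, l (h i)) ≤
      ∑ h : Fin (n + 1) → ι, ∑ j, (∑ i, l (h (Fin.succAbove j i)))⁻¹ :=
    sum_le_sum fun h _ => succ_sq_div_le_sum_inv hn (fun i => l (h i)) fun i => hl _
  have hn' : (0 : ℝ) < n := by exact_mod_cast hn
  rw [Finset.sum_comm] at h1
  have h2 : ∑ h : Fin (n + 1) → ι, ((n : ℝ) + 1) ^ 2 / (n * ∑ i, l (h i)) =
      ((n : ℝ) + 1) ^ 2 / n * tupleSum l (n + 1) (·⁻¹) := by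
    rw [tupleSum, Finset.mul_sum]
    exact sum_congr rfl fun h _ => by rw [← div_div, div_eq_mul_inv]
  simp only [sum_removeNth_eq l n (·⁻¹)] at h1
  rw [h2, sum_const, card_univ, Fintype.card_fin, nsmul_eq_mul, div_mul_eq_mul_div,
    div_le_iff₀ hn'] at h1
  push_cast at h1
  refine le_of_mul_le_mul_left ?_ (by positivity : (0 : ℝ) < n + 1)
  linarith

lemma mul_tupleSum_inv_le (hl : ∀ j, 0 < l j) {k n : ℕ} (hk : 0 < k) (hkn : k ≤ n) :
    (n : ℝ) * tupleSum l n (·⁻¹) ≤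
      (Fintype.card ι : ℝ) ^ (n - k) * (k * tupleSum l k (·⁻¹)) := by
  induction n, hkn using Nat.le_induction with
  | base => simp
  | succ n hkn ih =>
    have h := succ_mul_tupleSum_inv_le hl (hk.trans_le hkn)
    have hc : (0 : ℝ) ≤ Fintype.card ι := Nat.cast_nonneg _
    rw [Nat.succ_sub hkn, pow_succ]
    push_cast
    nlinarith [mul_le_mul_of_nonneg_left ih hc]

/-- A sum over triples is controlled by ordering the triples according to their largest entry. -/
lemma tupleSum_three_inv_le {c : ℝ} (hc : 0 < c) {μ : ι → ℕ} (hμ : ∀ j, 0 < μ j)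
    (hcard : ∀ j, (univ.filter fun i => μ i ≤ μ j).card ≤ 2 * μ j)
    (hl : ∀ j, c * (μ j : ℝ) ^ 2 ≤ l j) :
    tupleSum l 3 (·⁻¹) ≤ 12 * Fintype.card ι / c := by
  have hμ' : ∀ j, (0 : ℝ) < μ j := fun j => by exact_mod_cast hμ j
  set χ : ι → ι → ℝ := fun a b => if μ b ≤ μ a then 1 else 0 with hχ
  have hχ0 : ∀ a b, 0 ≤ χ a b := fun a b => by simp only [hχ]; split_ifs <;> norm_num
  set F : ι → ι → ι → ℝ := fun a b e => (c * (μ a : ℝ) ^ 2)⁻¹ * (χ a b * χ a e) with hF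
  have hF0 : ∀ a b e, 0 ≤ F a b e := fun a b e =>
    mul_nonneg (inv_nonneg.2 (by have := hμ' a; positivity)) (mul_nonneg (hχ0 _ _) (hχ0 _ _))
  have hl0 : ∀ j, 0 < l j := fun j =>
    lt_of_lt_of_le (by have := hμ' j; positivity) (hl j)
  have hmax : ∀ a b e x, l a ≤ x → μ b ≤ μ a → μ e ≤ μ a → x⁻¹ ≤ F a b e := by
    intro a b e x hx hb he
    simp only [hF, hχ, hb, he, if_true, mul_one]
    exact inv_anti₀ (by have := hμ' a; positivity) ((hl a).trans hx)
  have hpt : ∀ a b e, (l a + (l b + l e))⁻¹ ≤ F a b e + F b a e + F e a b := by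
    intro a b e
    have := hl0 a; have := hl0 b; have := hl0 e
    have := hF0 a b e; have := hF0 b a e; have := hF0 e a b
    by_cases h1 : μ b ≤ μ a ∧ μ e ≤ μ a
    · linarith [hmax a b e (l a + (l b + l e)) (by linarith) h1.1 h1.2]
    by_cases h2 : μ a ≤ μ b ∧ μ e ≤ μ b
    · linarith [hmax b a e (l a + (l b + l e)) (by linarith) h2.1 h2.2]
    · linarith [hmax e a b (l a + (l b + l e)) (by linarith) (by omega) (by omega)]
  have hsum : ∑ a, ∑ b, ∑ e, F a b e ≤ 4 * Fintype.card ι / c := by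
    have : ∀ a, ∑ b, ∑ e, F a b e ≤ 4 / c := by
      intro a
      have hN : ∑ b, χ a b ≤ 2 * μ a := by
        simp only [hχ, sum_boole]
        exact_mod_cast hcard a
      have hN0 : 0 ≤ ∑ b, χ a b := sum_nonneg fun b _ => hχ0 a b
      simp only [hF, ← Finset.mul_sum, ← Finset.sum_mul]
      have := hμ' a
      rw [inv_mul_le_iff₀ (by positivity)]
      calc _ ≤ (2 * μ a : ℝ) * (2 * μ a) := by gcongr
        _ = _ := by field_simp; ring
    calc _ ≤ ∑ _a : ι, 4 / c := sum_le_sum fun a _ => this a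
      _ = _ := by simp; ring
  have h1 : ∑ a, ∑ b, ∑ e, F b a e = ∑ a, ∑ b, ∑ e, F a b e := Finset.sum_comm
  have h2 : ∑ a, ∑ b, ∑ e, F e a b = ∑ a, ∑ b, ∑ e, F a b e := by
    calc _ = ∑ a, ∑ e, ∑ b, F e a b := sum_congr rfl fun a _ => Finset.sum_comm
      _ = _ := Finset.sum_comm
  calc tupleSum l 3 (·⁻¹) = ∑ a, ∑ b, ∑ e, (l a + (l b + l e))⁻¹ := by
        simp [tupleSum_succ, tupleSum_zero]
    _ ≤ ∑ a, ∑ b, ∑ e, (F a b e + F b a e + F e a b) :=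
        sum_le_sum fun a _ => sum_le_sum fun b _ => sum_le_sum fun e _ => hpt a b e
    _ = ∑ a, ∑ b, ∑ e, F a b e + ∑ a, ∑ b, ∑ e, F a b e + ∑ a, ∑ b, ∑ e, F a b e := by
        simp only [sum_add_distrib, h1, h2]
    _ ≤ _ := by
        have : 12 * (Fintype.card ι : ℝ) / c = 3 * (4 * Fintype.card ι / c) := by ring
        linarith

end tupleSum

lemma card_filter_min_le (m t : ℕ) :
    (univ.filter fun j : Fin m => min ((j : ℕ) + 1) (m - j) ≤ t).card ≤ 2 * t := by
  have hsub : (univ.filter fun j : Fin m => min ((j : ℕ) + 1) (m - j) ≤ t) ⊆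
      (univ.filter fun j : Fin m => (j : ℕ) + 1 ≤ t) ∪
        (univ.filter fun j : Fin m => m - (j : ℕ) ≤ t) := by
    intro j hj
    simp only [mem_filter, mem_univ, true_and, mem_union] at hj ⊢
    omega
  have h1 : (univ.filter fun j : Fin m => (j : ℕ) + 1 ≤ t).card ≤ (range t).card := by
    refine card_le_card_of_injOn (fun j => (j : ℕ)) (fun j hj => ?_) (Fin.val_injective.injOn)
    simp only [coe_filter, mem_univ, true_and, Set.mem_ofPred_eq] at hj
    simp only [coe_range, Set.mem_Iio]
    omega
  have h2 : (univ.filter fun j : Fin m => m - (j : ℕ) ≤ t).card ≤ (range t).card := by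
    refine card_le_card_of_injOn (fun j => m - 1 - (j : ℕ)) (fun j hj => ?_) ?_
    · simp only [coe_filter, mem_univ, true_and, Set.mem_ofPred_eq] at hj
      simp only [coe_range, Set.mem_Iio]
      omega
    · intro i _ j _ hij
      simp only at hij
      ext
      omega
  rw [card_range] at h1 h2
  have := (card_le_card hsub).trans (card_union_le _ _)
  omega

lemma sum_inv_succ_sq_le (m : ℕ) :
    ∑ j ∈ range m, (((j : ℝ) + 1) ^ 2)⁻¹ ≤ 2 - 1 / (m : ℝ) := by
  induction m with
  | zero => norm_num
  | succ m ih =>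
    rw [sum_range_succ]
    push_cast
    rcases m.eq_zero_or_pos with rfl | hm
    · norm_num
    · have hm' : (0 : ℝ) < m := by exact_mod_cast hm
      have h : (((m : ℝ) + 1) ^ 2)⁻¹ ≤ 1 / (m : ℝ) - 1 / (m + 1) := by
        rw [show 1 / (m : ℝ) - 1 / (m + 1) = ((m : ℝ) * (m + 1))⁻¹ by field_simp; ring]
        exact inv_anti₀ (by positivity) (by nlinarith)
      linarith

lemma sum_inv_min_sq_le (m : ℕ) :
    ∑ j : Fin m, (((min ((j : ℕ) + 1) (m - j) : ℕ) : ℝ) ^ 2)⁻¹ ≤ 4 := by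
  have hpt : ∀ j : Fin m, (((min ((j : ℕ) + 1) (m - j) : ℕ) : ℝ) ^ 2)⁻¹ ≤
      (((j : ℕ) + 1 : ℝ) ^ 2)⁻¹ + (((j.rev : ℕ) + 1 : ℝ) ^ 2)⁻¹ := by
    intro j
    have hrev : ((j.rev : ℕ) : ℝ) + 1 = ((m - j : ℕ) : ℝ) := by
      have : (j.rev : ℕ) + 1 = m - j := by rw [Fin.val_rev]; omega
      exact_mod_cast this
    rw [hrev]
    rcases min_choice ((j : ℕ) + 1) (m - j) with h | h <;> rw [h]
    · push_cast
      exact le_add_of_nonneg_right (by positivity)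
    · exact le_add_of_nonneg_left (by positivity)
  have hS := sum_inv_succ_sq_le m
  rw [← Fin.sum_univ_eq_sum_range (fun j => (((j : ℝ) + 1) ^ 2)⁻¹)] at hS
  have hR : ∑ j : Fin m, (((j.rev : ℕ) + 1 : ℝ) ^ 2)⁻¹ = ∑ j : Fin m, (((j : ℕ) + 1 : ℝ) ^ 2)⁻¹ :=
    Equiv.sum_comp Fin.revPerm (fun j : Fin m => (((j : ℕ) + 1 : ℝ) ^ 2)⁻¹)
  have h := sum_le_sum fun (j : Fin m) (_ : j ∈ univ) => hpt j
  rw [sum_add_distrib, hR] at h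
  have : (0 : ℝ) ≤ 1 / (m : ℝ) := by positivity
  linarith

/-- The eigenvalues of the Laplacian of the cycle of length `M`. -/
noncomputable def cycleEigenvalue (M k : ℕ) : ℝ :=
  2 - 2 * Real.cos (2 * Real.pi * k / M)

lemma cycleEigenvalue_zero (M : ℕ) : cycleEigenvalue M 0 = 0 := by
  simp [cycleEigenvalue]

lemma cycleEigenvalue_sub {M k : ℕ} (hM : 0 < M) (hk : k ≤ M) :
    cycleEigenvalue M (M - k) = cycleEigenvalue M k := by
  have : (M : ℝ) ≠ 0 := by positivity
  unfold cycleEigenvalue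
  rw [Nat.cast_sub hk, show 2 * π * ((M : ℝ) - k) / M = 2 * π - 2 * π * k / M by field_simp,
    Real.cos_two_pi_sub]

lemma le_cycleEigenvalue_of_two_mul_le {M k : ℕ} (hM : 0 < M) (hk : 2 * k ≤ M) :
    16 / (M : ℝ) ^ 2 * (k : ℝ) ^ 2 ≤ cycleEigenvalue M k := by
  have hM' : (0 : ℝ) < M := by exact_mod_cast hM
  have hk' : 2 * (k : ℝ) ≤ M := by exact_mod_cast hk
  have hx : π * k / M ≤ π / 2 := by
    rw [div_le_div_iff₀ hM' two_pos]
    nlinarith [Real.pi_pos]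
  have hs := Real.mul_le_sin (by positivity : 0 ≤ π * k / M) hx
  have hs' : 2 * (k : ℝ) / M ≤ Real.sin (π * k / M) := by
    refine le_of_eq_of_le ?_ hs
    field_simp
  have hsq := pow_le_pow_left₀ (by positivity) hs' 2
  unfold cycleEigenvalue
  rw [show 2 * π * (k : ℝ) / M = 2 * (π * k / M) by ring, Real.cos_two_mul, Real.cos_sq']
  calc 16 / (M : ℝ) ^ 2 * (k : ℝ) ^ 2 = 4 * (2 * (k : ℝ) / M) ^ 2 := by ring
    _ ≤ _ := by linarith

lemma le_cycleEigenvalue {m j : ℕ} (hj : j < m) :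
    16 / ((m + 1 : ℕ) : ℝ) ^ 2 * ((min (j + 1) (m - j) : ℕ) : ℝ) ^ 2 ≤
      cycleEigenvalue (m + 1) (j + 1) := by
  rcases le_total (j + 1) (m - j) with h | h
  · rw [min_eq_left h]
    exact le_cycleEigenvalue_of_two_mul_le m.succ_pos (by omega)
  · rw [min_eq_right h, ← cycleEigenvalue_sub m.succ_pos (by omega : j + 1 ≤ m + 1),
      show m + 1 - (j + 1) = m - j by omega]
    exact le_cycleEigenvalue_of_two_mul_le m.succ_pos (by omega)

lemma RaveTorus_eq (d m : ℕ) :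
    RaveTorus d (m + 1) = 1 / ((m + 1 : ℕ) : ℝ) ^ d *
      ∑ n ∈ range (d + 1), (d.choose n : ℝ) *
        tupleSum (fun j : Fin m => cycleEigenvalue (m + 1) (j + 1)) n (·⁻¹) := by
  have h := tupleSum_eq_sum_choose (fun j : Fin (m + 1) => cycleEigenvalue (m + 1) j)
    (by simp [cycleEigenvalue]) d (·⁻¹)
  simp only [Fin.val_succ] at h
  rw [← h, RaveTorus, tupleSum]
  congr 1
  refine sum_congr rfl fun k _ => ?_
  split_ifs with hk
  · simp [hk, cycleEigenvalue_zero]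
  · simp only [cycleEigenvalue, sum_sub_distrib, ← Finset.mul_sum, one_div]
    simp [mul_comm]

section cycle

variable (m : ℕ)

lemma tupleSum_cycle_one_le :
    tupleSum (fun j : Fin m => cycleEigenvalue (m + 1) (j + 1)) 1 (·⁻¹) ≤
      ((m : ℝ) + 1) ^ 2 / 4 := by
  have h : ∀ j : Fin m, (cycleEigenvalue (m + 1) (j + 1))⁻¹ ≤
      ((m : ℝ) + 1) ^ 2 / 16 * (((min ((j : ℕ) + 1) (m - j) : ℕ) : ℝ) ^ 2)⁻¹ := by
    intro j
    have hpos : (0 : ℝ) < (min ((j : ℕ) + 1) (m - j) : ℕ) := by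
      exact_mod_cast (by omega : 0 < min ((j : ℕ) + 1) (m - j))
    refine (inv_anti₀ (by positivity) (le_cycleEigenvalue j.2)).trans (le_of_eq ?_)
    rw [mul_inv, inv_div]
    push_cast
    rfl
  simp only [tupleSum_succ, tupleSum_zero, add_zero]
  calc _ ≤ ∑ j : Fin m,
        ((m : ℝ) + 1) ^ 2 / 16 * (((min ((j : ℕ) + 1) (m - j) : ℕ) : ℝ) ^ 2)⁻¹ :=
        sum_le_sum fun j _ => h j
    _ ≤ ((m : ℝ) + 1) ^ 2 / 16 * 4 := by
        rw [← Finset.mul_sum]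
        exact mul_le_mul_of_nonneg_left (sum_inv_min_sq_le m) (by positivity)
    _ = _ := by ring

lemma cycleEigenvalue_pos (j : Fin m) : 0 < cycleEigenvalue (m + 1) (j + 1) := by
  have hpos : (0 : ℝ) < (min ((j : ℕ) + 1) (m - j) : ℕ) := by
    exact_mod_cast (by omega : 0 < min ((j : ℕ) + 1) (m - j))
  exact lt_of_lt_of_le (by positivity) (le_cycleEigenvalue j.2)

lemma tupleSum_cycle_two_le :
    tupleSum (fun j : Fin m => cycleEigenvalue (m + 1) (j + 1)) 2 (·⁻¹) ≤
      m * ((m : ℝ) + 1) ^ 2 / 8 := by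
  have h := succ_mul_tupleSum_inv_le (cycleEigenvalue_pos m) one_pos
  have h1 := mul_le_mul_of_nonneg_left (tupleSum_cycle_one_le m) (Nat.cast_nonneg m)
  rw [Fintype.card_fin] at h
  push_cast at h
  linarith

lemma tupleSum_cycle_three_le :
    tupleSum (fun j : Fin m => cycleEigenvalue (m + 1) (j + 1)) 3 (·⁻¹) ≤
      3 / 4 * m * ((m : ℝ) + 1) ^ 2 := by
  have h := tupleSum_three_inv_le (l := fun j : Fin m => cycleEigenvalue (m + 1) (j + 1))
    (c := 16 / ((m + 1 : ℕ) : ℝ) ^ 2) (by positivity)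
    (μ := fun j => min ((j : ℕ) + 1) (m - j)) (fun j => by omega)
    (fun j => card_filter_min_le m _) (fun j => le_cycleEigenvalue j.2)
  refine h.trans (le_of_eq ?_)
  rw [Fintype.card_fin]
  push_cast
  field_simp
  ring

lemma mul_tupleSum_cycle_le {n : ℕ} (hn : 3 ≤ n) :
    (n : ℝ) * tupleSum (fun j : Fin m => cycleEigenvalue (m + 1) (j + 1)) n (·⁻¹) * m ^ 2 ≤
      9 / 4 * ((m : ℝ) + 1) ^ 2 * m ^ n := by
  have h := mul_tupleSum_inv_le (cycleEigenvalue_pos m) three_pos hn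
  rw [Fintype.card_fin] at h
  obtain ⟨k, rfl⟩ := Nat.exists_eq_add_of_le hn
  rw [Nat.add_sub_cancel_left] at h
  calc _ ≤ (m : ℝ) ^ k * (3 * (3 / 4 * m * ((m : ℝ) + 1) ^ 2)) * m ^ 2 := by
        refine mul_le_mul_of_nonneg_right (h.trans ?_) (by positivity)
        have := tupleSum_cycle_three_le m
        push_cast
        gcongr
    _ = _ := by ring

/-- Contribution of all tuples with at least three nonzero entries, in a form that sums
by the binomial theorem. -/
lemma choose_mul_tupleSum_cycle_le {d n : ℕ} (hm : 0 < m) (hn : 3 ≤ n) :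
    (d.choose n : ℝ) * tupleSum (fun j : Fin m => cycleEigenvalue (m + 1) (j + 1)) n (·⁻¹) ≤
      3 * ((m : ℝ) + 1) ^ 2 / (m ^ 3 * (d + 1)) * ((d + 1).choose (n + 1) * m ^ (n + 1)) := by
  have hm' : (0 : ℝ) < m := by exact_mod_cast hm
  have hn' : (3 : ℝ) ≤ n := by exact_mod_cast hn
  have h := mul_tupleSum_cycle_le m hn
  set A := tupleSum (fun j : Fin m => cycleEigenvalue (m + 1) (j + 1)) n (·⁻¹)
  have hA : A ≤ 3 * ((m : ℝ) + 1) ^ 2 * m ^ n / (m ^ 2 * (n + 1)) := by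
    rw [le_div_iff₀ (by positivity)]
    have hX : 0 ≤ ((m : ℝ) + 1) ^ 2 * m ^ n := by positivity
    refine le_of_mul_le_mul_left ?_ (by linarith : (0 : ℝ) < n)
    nlinarith [mul_le_mul_of_nonneg_right h (by positivity : (0 : ℝ) ≤ n + 1)]
  have hc : ((d : ℝ) + 1) * d.choose n = (d + 1).choose (n + 1) * (n + 1) := by
    exact_mod_cast Nat.add_one_mul_choose_eq d n
  calc _ ≤ (d.choose n : ℝ) * (3 * ((m : ℝ) + 1) ^ 2 * m ^ n / (m ^ 2 * (n + 1))) := by gcongr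
    _ = ((d + 1) * d.choose n) *
          (3 * ((m : ℝ) + 1) ^ 2 * m ^ n / (m ^ 2 * (n + 1) * (d + 1))) := by field_simp
    _ = _ := by rw [hc]; field_simp; ring

lemma sum_choose_mul_tupleSum_cycle_le {d : ℕ} (hd : 2 ≤ d) (hm : 0 < m) :
    ∑ n ∈ range (d + 1), (d.choose n : ℝ) *
        tupleSum (fun j : Fin m => cycleEigenvalue (m + 1) (j + 1)) n (·⁻¹) ≤
      d * (((m : ℝ) + 1) ^ 2 / 4) + d * (d - 1) / 2 * (m * ((m : ℝ) + 1) ^ 2 / 8) +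
        3 * ((m : ℝ) + 1) ^ (d + 3) / (m ^ 3 * (d + 1)) := by
  have hm' : (0 : ℝ) < m := by exact_mod_cast hm
  set A := fun n => tupleSum (fun j : Fin m => cycleEigenvalue (m + 1) (j + 1)) n (·⁻¹) with hA
  set B := fun n : ℕ => ((d + 1).choose n * (m : ℝ) ^ n) with hB
  set K := 3 * ((m : ℝ) + 1) ^ 2 / (m ^ 3 * (d + 1)) with hK
  have hK0 : 0 ≤ K := by positivity
  have hB0 : ∀ n, 0 ≤ B n := fun n => by positivity
  obtain ⟨e, rfl⟩ := Nat.exists_eq_add_of_le' hd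
  have hbinom : ∑ n ∈ range (e + 2 + 2), B n = ((m : ℝ) + 1) ^ (e + 2 + 1) := by
    rw [add_pow]
    exact sum_congr rfl fun n _ => by simp [hB, mul_comm]
  have hsplit : ∑ n ∈ range (e + 2 + 2), B n =
      ∑ n ∈ range e, B (n + 3 + 1) + B 3 + B 2 + B 1 + B 0 := by
    simp [sum_range_succ']
  have htail : ∑ n ∈ range e, ((e + 2).choose (n + 3) : ℝ) * A (n + 3) ≤
      K * ((m : ℝ) + 1) ^ (e + 2 + 1) := by
    calc _ ≤ ∑ n ∈ range e, K * B (n + 3 + 1) :=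
          sum_le_sum fun n _ => choose_mul_tupleSum_cycle_le m hm (by omega)
      _ = K * ∑ n ∈ range e, B (n + 3 + 1) := by rw [Finset.mul_sum]
      _ ≤ _ := by
          rw [← hbinom, hsplit]
          gcongr
          linarith [hB0 0, hB0 1, hB0 2, hB0 3]
  have h0 : A 0 = 0 := by simp [hA, tupleSum_zero]
  have h1 : A 1 ≤ ((m : ℝ) + 1) ^ 2 / 4 := tupleSum_cycle_one_le m
  have h2 : A 2 ≤ m * ((m : ℝ) + 1) ^ 2 / 8 := tupleSum_cycle_two_le m
  have hKeq : K * ((m : ℝ) + 1) ^ (e + 2 + 1) =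
      3 * ((m : ℝ) + 1) ^ (e + 2 + 3) / (m ^ 3 * ((e + 2 : ℕ) + 1)) := by
    rw [hK, div_mul_eq_mul_div]
    ring
  have hc : ((e + 2).choose 2 : ℝ) = (e + 2 : ℕ) * ((e + 2 : ℕ) - 1) / 2 :=
    Nat.cast_choose_two ℝ (e + 2)
  rw [← hKeq, ← hc]
  calc ∑ n ∈ range (e + 2 + 1), ((e + 2).choose n : ℝ) * A n
      = ∑ n ∈ range e, ((e + 2).choose (n + 3) : ℝ) * A (n + 3) + ((e + 2).choose 2 : ℝ) * A 2 +
          (e + 2 : ℕ) * A 1 := by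
        simp [sum_range_succ', h0]
    _ ≤ K * ((m : ℝ) + 1) ^ (e + 2 + 1) + ((e + 2).choose 2 : ℝ) * (m * ((m : ℝ) + 1) ^ 2 / 8) +
          (e + 2 : ℕ) * (((m : ℝ) + 1) ^ 2 / 4) := by gcongr
    _ = _ := by ring

end cycle

lemma cube_sub_self_le (k : ℕ) :
    ((k : ℝ) + 3) * (k + 2) * (k + 4) ≤ 24 * 4 ^ k := by
  induction k with
  | zero => norm_num
  | succ k ih =>
    rw [pow_succ]
    push_cast
    nlinarith [(Nat.cast_nonneg k : (0 : ℝ) ≤ k), sq_nonneg (k : ℝ)]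

lemma one_le_third_add_log {d M : ℝ} (hd : 3 ≤ d) (hM : 4 ≤ M) :
    1 ≤ 1 / 3 + (d - 1) * Real.log M / π := by
  have h2 : Real.log 4 = 2 * Real.log 2 := by
    rw [show (4 : ℝ) = 2 ^ 2 by norm_num, Real.log_pow]; norm_num
  have h4 : 1.38 ≤ Real.log M := by
    have := Real.log_le_log (by norm_num) hM
    linarith [Real.log_two_gt_d9]
  have : 2 / 3 ≤ (d - 1) * Real.log M / π := by
    rw [le_div_iff₀ Real.pi_pos]
    nlinarith [Real.pi_lt_d2]
  linarith

lemma three_mul_div_cube_le {m : ℝ} (hm : 3 ≤ m) {k : ℕ} (hk : 3 ≤ k) :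
    3 * ((m + 1) / m) ^ 3 + 3 / 2 ≤ 8 * (1 + 1 / (m + 1)) ^ k := by
  have h1 : (1 : ℝ) ≤ 1 + 1 / (m + 1) := by
    have : 0 ≤ 1 / (m + 1) := by positivity
    linarith
  have h2 : (m + 1) / m ≤ 16 / 15 * (1 + 1 / (m + 1)) := by
    rw [div_le_iff₀ (by linarith)]
    field_simp
    nlinarith
  have h3 := pow_le_pow_left₀ (by positivity) h2 3
  have h4 := pow_le_pow_right₀ h1 hk
  have h5 := one_le_pow₀ h1 (n := 3)
  rw [mul_pow] at h3
  linarith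

theorem torusd_upper (d M : ℕ) (hd : 3 ≤ d) (hM : 4 ≤ M) :
    RaveTorus d M ≤ (8 / ((d : ℝ) + 1)) * (1 + 1 / M) ^ (d + 1)
      + ((d : ℝ) / (4 * (M : ℝ) ^ (d - 2))) * (1 / 3 + ((d : ℝ) - 1) * Real.log M / Real.pi) := by
  obtain ⟨m, rfl⟩ : ∃ m, M = m + 1 := ⟨M - 1, by omega⟩
  obtain ⟨k, rfl⟩ : ∃ k, d = k + 3 := ⟨d - 3, by omega⟩
  have hm : (3 : ℝ) ≤ m := by exact_mod_cast (by omega : 3 ≤ m)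
  have hsum := sum_choose_mul_tupleSum_cycle_le m (by omega : 2 ≤ k + 3) (by omega : 0 < m)
  have hlog := one_le_third_add_log (d := ((k + 3 : ℕ) : ℝ)) (M := ((m + 1 : ℕ) : ℝ))
    (by exact_mod_cast hd) (by exact_mod_cast hM)
  have hmain := three_mul_div_cube_le hm (by omega : 3 ≤ k + 3 + 1)
  have hcube : ((k : ℝ) + 3) * (k + 2) * (k + 4) ≤ 24 * ((m : ℝ) + 1) ^ k :=
    (cube_sub_self_le k).trans (by gcongr; linarith)
  rw [RaveTorus_eq, show k + 3 - 2 = k + 1 by omega]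
  push_cast at hsum hlog hmain ⊢
  have hpair : ((k : ℝ) + 3) * (k + 3 - 1) / 2 * (m * ((m : ℝ) + 1) ^ 2 / 8) ≤
      3 / 2 / (k + 3 + 1) * (m + 1) ^ (k + 3) := by
    rw [div_mul_eq_mul_div (3 / 2 : ℝ), le_div_iff₀ (by positivity)]
    calc _ = ((k : ℝ) + 3) * (k + 2) * (k + 4) * (m * ((m : ℝ) + 1) ^ 2 / 16) := by ring
      _ ≤ 24 * ((m : ℝ) + 1) ^ k * ((m + 1) * ((m : ℝ) + 1) ^ 2 / 16) := by
          gcongr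
          linarith
      _ = _ := by ring
  calc _ ≤ 1 / ((m : ℝ) + 1) ^ (k + 3) * (((k : ℝ) + 3) * (((m : ℝ) + 1) ^ 2 / 4) +
          3 / 2 / (k + 3 + 1) * (m + 1) ^ (k + 3) +
          3 * ((m : ℝ) + 1) ^ (k + 3 + 3) / (m ^ 3 * (k + 3 + 1))) := by
        gcongr
        linarith
    _ = (3 * (((m : ℝ) + 1) / m) ^ 3 + 3 / 2) / (k + 3 + 1) +
          ((k : ℝ) + 3) / (4 * ((m : ℝ) + 1) ^ (k + 1)) * 1 := by
        field_simp
        ring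
    _ ≤ 8 * (1 + 1 / ((m : ℝ) + 1)) ^ (k + 3 + 1) / (k + 3 + 1) +
          ((k : ℝ) + 3) / (4 * ((m : ℝ) + 1) ^ (k + 1)) *
            (1 / 3 + ((k : ℝ) + 3 - 1) * Real.log (m + 1) / π) := by gcongr
    _ = _ := by ring
end

section
/- For every integer d ≥ 3, the integral R_d^cont = ∫_{[0,1]^d} 1/(2d − 2·Σ_{i=1}^d cos(2π x_i)) dx satisfies 1/(4d) ≤ R_d^cont ≤ 4/d. -/
open Real MeasureTheory

/-- Continuous approximation of the average effective resistance of the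
`d`-dimensional toroidal grid. -/
noncomputable def RaveCont (d : ℕ) : ℝ :=
  ∫ x in (Set.univ.pi fun _ : Fin d => Set.Icc (0 : ℝ) 1),
    1 / (2 * d - 2 * ∑ i, Real.cos (2 * Real.pi * x i))

/-- The cubic lower bound for the sine, via the triple-angle formula. -/
lemma cubic_le_sin_pi_mul {x : ℝ} (h0 : 0 ≤ x) (h1 : x ≤ 1 / 2) :
    x * (3 - 4 * x ^ 2) ≤ sin (π * x) := by
  have hpi := pi_pos
  have hx : x ≤ sin (π * x / 3) := by
    have h := strictConcaveOn_sin_Icc.concaveOn.2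
      (show (0 : ℝ) ∈ Set.Icc 0 π from ⟨le_rfl, hpi.le⟩)
      (show π / 6 ∈ Set.Icc 0 π from ⟨by linarith, by linarith⟩)
      (show 0 ≤ 1 - 2 * x by linarith) (show 0 ≤ 2 * x by linarith) (by ring)
    simp only [smul_eq_mul, sin_zero, sin_pi_div_six] at h
    have e : (1 - 2 * x) * 0 + 2 * x * (π / 6) = π * x / 3 := by ring
    rw [e] at h
    linarith
  have hy : sin (π * x / 3) ≤ 1 / 2 := by
    rw [← sin_pi_div_six]
    exact sin_le_sin_of_le_of_le_pi_div_two (by nlinarith) (by linarith) (by nlinarith)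
  have e : π * x = 3 * (π * x / 3) := by ring
  rw [e, sin_three_mul]
  generalize sin (π * x / 3) = s at hx hy
  nlinarith [mul_nonneg (sub_nonneg.2 hx) (sub_nonneg.2 hy),
    mul_nonneg (sub_nonneg.2 hx) (sub_nonneg.2 h1),
    mul_nonneg (sub_nonneg.2 hx) (show 0 ≤ 3 - 4 * (s ^ 2 + s * x + x ^ 2) by nlinarith)]

/-- The `2/3`-power of the cosecant of `π x`. -/
noncomputable def cscPow (x : ℝ) : ℝ := (sin (π * x) ^ 2) ^ (-(1 / 3) : ℝ)

lemma measurable_cscPow : Measurable cscPow := by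
  unfold cscPow; fun_prop

lemma cscPow_nonneg (x : ℝ) : 0 ≤ cscPow x := by
  unfold cscPow; positivity

lemma cscPow_one_sub (x : ℝ) : cscPow (1 - x) = cscPow x := by
  unfold cscPow
  rw [mul_sub, mul_one, sin_pi_sub]

lemma cscPow_le {x : ℝ} (h0 : 0 < x) (h1 : x ≤ 1 / 2) :
    cscPow x ≤ 1 / 2 * x ^ (-(2 / 3) : ℝ) + 3 / 5 * x ^ (4 / 3 : ℝ) := by
  set q : ℝ := 1 / 2 + 3 / 5 * x ^ 2 with hq
  have hq0 : 0 < q := by positivity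
  have hv1 : 4 * x ^ 2 ≤ 1 := by nlinarith
  have hpoly : 1 ≤ (3 - 4 * x ^ 2) ^ 2 * q ^ 3 := by
    have hq' : q = 1 / 2 + 3 / 20 * (4 * x ^ 2) := by rw [hq]; ring
    have hv0 : 0 ≤ 4 * x ^ 2 := by positivity
    rw [hq']
    generalize 4 * x ^ 2 = v at hv0 hv1
    have h3 : 1 / 8 + 9 / 80 * v + 27 / 800 * v ^ 2 ≤ (1 / 2 + 3 / 20 * v) ^ 3 := by
      have : 0 ≤ v ^ 2 := by positivity
      have : 0 ≤ v ^ 3 := by positivity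
      nlinarith
    have h4 : 1 ≤ (3 - v) ^ 2 * (1 / 8 + 9 / 80 * v + 27 / 800 * v ^ 2) := by
      nlinarith [mul_nonneg hv0 (sub_nonneg.2 hv1),
        mul_nonneg (mul_nonneg hv0 hv0) (sub_nonneg.2 hv1)]
    exact h4.trans (mul_le_mul_of_nonneg_left h3 (sq_nonneg _))
  have hsin := cubic_le_sin_pi_mul h0.le h1
  have hs2 : (x * (3 - 4 * x ^ 2)) ^ 2 ≤ sin (π * x) ^ 2 :=
    pow_le_pow_left₀ (mul_nonneg h0.le (by linarith)) hsin 2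
  have hle : x ^ 2 * (q ^ 3)⁻¹ ≤ sin (π * x) ^ 2 := by
    refine le_trans ?_ hs2
    rw [← div_eq_mul_inv, div_le_iff₀ (by positivity)]
    nlinarith [mul_le_mul_of_nonneg_left hpoly (sq_nonneg x)]
  calc cscPow x ≤ (x ^ 2 * (q ^ 3)⁻¹) ^ (-(1 / 3) : ℝ) :=
        rpow_le_rpow_of_nonpos (by positivity) hle (by norm_num)
    _ = x ^ (-(2 / 3) : ℝ) * q := by
        rw [mul_rpow (by positivity) (by positivity), rpow_neg (x := (q ^ 3)⁻¹) (by positivity),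
          inv_rpow (by positivity), inv_inv, ← rpow_natCast, ← rpow_natCast,
          ← rpow_mul h0.le, ← rpow_mul hq0.le]
        norm_num
    _ = _ := by
        have : x ^ (4 / 3 : ℝ) = x ^ (-(2 / 3) : ℝ) * x ^ 2 := by
          rw [← rpow_natCast, ← rpow_add h0]; norm_num
        rw [this, hq]; ring

lemma intervalIntegrable_cscPow_bound :
    IntervalIntegrable (fun x : ℝ => 1 / 2 * x ^ (-(2 / 3) : ℝ) + 3 / 5 * x ^ (4 / 3 : ℝ))
      volume 0 (1 / 2) :=
  ((intervalIntegral.intervalIntegrable_rpow' (by norm_num)).const_mul _).add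
    ((intervalIntegral.intervalIntegrable_rpow' (by norm_num)).const_mul _)

lemma intervalIntegrable_cscPow_half : IntervalIntegrable cscPow volume 0 (1 / 2) := by
  refine intervalIntegrable_cscPow_bound.mono_fun' measurable_cscPow.aestronglyMeasurable ?_
  filter_upwards [ae_restrict_mem measurableSet_uIoc] with x hx
  rw [Set.uIoc_of_le (by norm_num)] at hx
  rw [norm_of_nonneg (cscPow_nonneg x)]
  exact cscPow_le hx.1 hx.2

lemma intervalIntegrable_cscPow_half_one : IntervalIntegrable cscPow volume (1 / 2) 1 := by
  have h := intervalIntegrable_cscPow_half.comp_sub_left 1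
  simp only [cscPow_one_sub] at h
  norm_num at h ⊢
  exact h.symm

lemma integral_cscPow_half_le : ∫ x in (0 : ℝ)..(1 / 2), cscPow x ≤ 5 / 4 := by
  have hk : ((1 / 2 : ℝ)) ^ (1 / 3 : ℝ) ≤ 795 / 1000 := by
    refine le_of_pow_le_pow_left₀ (n := 3) (by norm_num) (by norm_num) ?_
    rw [← rpow_natCast, ← rpow_mul (by norm_num)]
    norm_num
  calc ∫ x in (0 : ℝ)..(1 / 2), cscPow x
      ≤ ∫ x in (0 : ℝ)..(1 / 2), (1 / 2 * x ^ (-(2 / 3) : ℝ) + 3 / 5 * x ^ (4 / 3 : ℝ)) :=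
        intervalIntegral.integral_mono_on_of_le_Ioo (by norm_num)
          intervalIntegrable_cscPow_half intervalIntegrable_cscPow_bound
          fun x hx => cscPow_le hx.1 hx.2.le
    _ = (3 / 2 + 9 / 140) * (1 / 2 : ℝ) ^ (1 / 3 : ℝ) := by
        rw [intervalIntegral.integral_add
          ((intervalIntegral.intervalIntegrable_rpow' (by norm_num)).const_mul _)
          ((intervalIntegral.intervalIntegrable_rpow' (by norm_num)).const_mul _),
          intervalIntegral.integral_const_mul, intervalIntegral.integral_const_mul,
          integral_rpow (Or.inl (by norm_num)), integral_rpow (Or.inl (by norm_num)),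
          zero_rpow (by norm_num), zero_rpow (by norm_num)]
        have e1 : (1 / 2 : ℝ) ^ ((4 / 3 : ℝ) + 1) = (1 / 2 : ℝ) ^ (1 / 3 : ℝ) * (1 / 4) := by
          rw [show (4 / 3 : ℝ) + 1 = 1 / 3 + (2 : ℕ) by norm_num, rpow_add (by norm_num),
            rpow_natCast]
          norm_num
        have e2 : (-(2 / 3) : ℝ) + 1 = 1 / 3 := by norm_num
        rw [e1, e2]
        ring
    _ ≤ 5 / 4 := by linarith

lemma integrableOn_cscPow : IntegrableOn cscPow (Set.Ioo 0 1) := by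
  have h := intervalIntegrable_cscPow_half.trans intervalIntegrable_cscPow_half_one
  exact ((intervalIntegrable_iff_integrableOn_Ioc_of_le zero_le_one).1 h).mono_set
    Set.Ioo_subset_Ioc_self

lemma setIntegral_cscPow_le : ∫ x in Set.Ioo (0 : ℝ) 1, cscPow x ≤ 5 / 2 := by
  rw [← integral_Ioc_eq_integral_Ioo, ← intervalIntegral.integral_of_le zero_le_one,
    ← intervalIntegral.integral_add_adjacent_intervals intervalIntegrable_cscPow_half
      intervalIntegrable_cscPow_half_one]
  have h : ∫ x in (1 / 2 : ℝ)..1, cscPow x = ∫ x in (0 : ℝ)..(1 / 2), cscPow x := by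
    have h := intervalIntegral.integral_comp_sub_left (a := 0) (b := 1 / 2) cscPow 1
    simp only [cscPow_one_sub] at h
    rw [h]
    norm_num
  rw [h]
  linarith [integral_cscPow_half_le]

/-- The one-variable factor of a product majorant of the integrand in dimension `d`. -/
noncomputable def majorantFactor (d : ℕ) (x : ℝ) : ℝ :=
  (5 / 2 : ℝ) ^ (3 / d : ℝ) * (1 + 3 / d * (cscPow x / (5 / 2) - 1))

lemma integrableOn_majorantFactor (d : ℕ) : IntegrableOn (majorantFactor d) (Set.Ioo 0 1) := by
  have hc (c : ℝ) : IntegrableOn (fun _ : ℝ => c) (Set.Ioo 0 1) :=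
    integrableOn_const (by simp)
  exact ((hc 1).add (((integrableOn_cscPow.div_const _).sub (hc 1)).const_mul _)).const_mul _

lemma rpow_le_majorantFactor {d : ℕ} (hd : 3 ≤ d) {x : ℝ} :
    (sin (π * x) ^ 2) ^ (-(1 / d) : ℝ) ≤ majorantFactor d x := by
  have hd3 : (3 : ℝ) ≤ d := by exact_mod_cast hd
  have hd0 : (0 : ℝ) < d := by linarith
  have e : (sin (π * x) ^ 2) ^ (-(1 / d) : ℝ) = cscPow x ^ (3 / d : ℝ) := by
    unfold cscPow
    rw [← rpow_mul (sq_nonneg _)]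
    congr 1
    field_simp
  have hy := cscPow_nonneg x
  have hb := rpow_one_add_le_one_add_mul_self (s := cscPow x / (5 / 2) - 1) (p := 3 / d)
    (by linarith [show 0 ≤ cscPow x / (5 / 2) by positivity]) (by positivity)
    ((div_le_one hd0).2 hd3)
  rw [add_sub_cancel] at hb
  rw [e, majorantFactor]
  calc cscPow x ^ (3 / d : ℝ) = (5 / 2 * (cscPow x / (5 / 2))) ^ (3 / d : ℝ) := by
        congr 1; ring
    _ = (5 / 2 : ℝ) ^ (3 / d : ℝ) * (cscPow x / (5 / 2)) ^ (3 / d : ℝ) :=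
        mul_rpow (by norm_num) (by positivity)
    _ ≤ _ := mul_le_mul_of_nonneg_left hb (by positivity)

lemma setIntegral_majorantFactor_nonneg {d : ℕ} (hd : 3 ≤ d) :
    0 ≤ ∫ x in Set.Ioo (0 : ℝ) 1, majorantFactor d x :=
  integral_nonneg fun _ => (rpow_nonneg (sq_nonneg _) _).trans (rpow_le_majorantFactor hd)

lemma setIntegral_majorantFactor_le (d : ℕ) :
    ∫ x in Set.Ioo (0 : ℝ) 1, majorantFactor d x ≤ (5 / 2 : ℝ) ^ (3 / d : ℝ) := by
  have hc (c : ℝ) : IntegrableOn (fun _ : ℝ => c) (Set.Ioo 0 1) :=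
    integrableOn_const (by simp)
  have hsub : IntegrableOn (fun x => cscPow x / (5 / 2) - 1) (Set.Ioo 0 1) :=
    (integrableOn_cscPow.div_const (5 / 2)).sub (hc 1)
  have e : ∫ x in Set.Ioo (0 : ℝ) 1, majorantFactor d x
      = (5 / 2 : ℝ) ^ (3 / d : ℝ) *
        (1 + 3 / d * ((∫ x in Set.Ioo (0 : ℝ) 1, cscPow x) / (5 / 2) - 1)) := by
    unfold majorantFactor
    rw [integral_const_mul, integral_add (hc 1) (hsub.const_mul _), integral_const_mul,
      integral_sub (integrableOn_cscPow.div_const _) (hc 1), integral_div]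
    simp
  rw [e]
  refine mul_le_of_le_one_right (by positivity) ?_
  have h := setIntegral_cscPow_le
  have : 3 / (d : ℝ) * ((∫ x in Set.Ioo (0 : ℝ) 1, cscPow x) / (5 / 2) - 1) ≤ 0 :=
    mul_nonpos_of_nonneg_of_nonpos (by positivity) (by linarith)
  linarith

lemma one_div_sum_le_prod {d : ℕ} (hd : 0 < d) {s : Fin d → ℝ} (hs : ∀ i, 0 < s i) :
    1 / ∑ i, s i ≤ 1 / d * ∏ i, s i ^ (-(1 / d) : ℝ) := by
  have hd0 : (0 : ℝ) < d := by exact_mod_cast hd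
  have h := geom_mean_le_arith_mean_weighted Finset.univ (fun _ : Fin d => (1 / d : ℝ)) s
    (fun _ _ => by positivity) (by simp [hd0.ne']) (fun i _ => (hs i).le)
  rw [← Finset.mul_sum] at h
  have hp : 0 < ∏ i, s i ^ (1 / d : ℝ) := Finset.prod_pos fun i _ => rpow_pos_of_pos (hs i) _
  have e : ∏ i, s i ^ (-(1 / d) : ℝ) = (∏ i, s i ^ (1 / d : ℝ))⁻¹ := by
    rw [← Finset.prod_inv_distrib]
    exact Finset.prod_congr rfl fun i _ => rpow_neg (hs i).le _
  rw [e]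
  calc 1 / ∑ i, s i = 1 / d * (1 / d * ∑ i, s i)⁻¹ := by
        rw [mul_inv, one_div (d : ℝ), inv_inv, inv_mul_cancel_left₀ hd0.ne', one_div]
    _ ≤ _ := by gcongr

lemma denominator_eq (d : ℕ) (x : Fin d → ℝ) :
    2 * (d : ℝ) - 2 * ∑ i, cos (2 * π * x i) = 4 * ∑ i, sin (π * x i) ^ 2 := by
  have h (i : Fin d) : cos (2 * π * x i) = 1 - 2 * sin (π * x i) ^ 2 := by
    rw [mul_assoc, cos_two_mul, cos_sq']; ring
  simp only [h, Finset.sum_sub_distrib, ← Finset.mul_sum]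
  simp
  ring

lemma integrand_le {d : ℕ} (hd : 3 ≤ d) {x : Fin d → ℝ} (hx : ∀ i, x i ∈ Set.Ioo (0 : ℝ) 1) :
    1 / (2 * (d : ℝ) - 2 * ∑ i, cos (2 * π * x i))
      ≤ 1 / (4 * d) * ∏ i, majorantFactor d (x i) := by
  have hs (i : Fin d) : 0 < sin (π * x i) ^ 2 :=
    pow_pos (sin_pos_of_pos_of_lt_pi (mul_pos pi_pos (hx i).1)
      (mul_lt_of_lt_one_right pi_pos (hx i).2)) 2
  have h := one_div_sum_le_prod (by omega) hs
  have h2 : ∏ i, (sin (π * x i) ^ 2) ^ (-(1 / d) : ℝ) ≤ ∏ i, majorantFactor d (x i) :=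
    Finset.prod_le_prod (fun i _ => by positivity) fun i _ => rpow_le_majorantFactor hd
  rw [denominator_eq]
  calc 1 / (4 * ∑ i, sin (π * x i) ^ 2) = 1 / 4 * (1 / ∑ i, sin (π * x i) ^ 2) := by
        rw [one_div_mul_one_div]
    _ ≤ 1 / 4 * (1 / d * ∏ i, majorantFactor d (x i)) := by
        gcongr
        exact h.trans (by gcongr)
    _ = _ := by rw [← mul_assoc, one_div_mul_one_div]

lemma le_integrand {d : ℕ} (hd : 0 < d) {x : Fin d → ℝ} (hx : ∀ i, x i ∈ Set.Ioo (0 : ℝ) 1) :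
    1 / (4 * (d : ℝ)) ≤ 1 / (2 * (d : ℝ) - 2 * ∑ i, cos (2 * π * x i)) := by
  have hs (i : Fin d) : 0 < sin (π * x i) ^ 2 :=
    pow_pos (sin_pos_of_pos_of_lt_pi (mul_pos pi_pos (hx i).1)
      (mul_lt_of_lt_one_right pi_pos (hx i).2)) 2
  rw [denominator_eq]
  have : 0 < ∑ i, sin (π * x i) ^ 2 :=
    Finset.sum_pos (fun i _ => hs i) ⟨⟨0, hd⟩, Finset.mem_univ _⟩
  have h : ∑ i, sin (π * x i) ^ 2 ≤ d := by
    simpa using Finset.sum_le_card_nsmul Finset.univ (fun i => sin (π * x i) ^ 2) 1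
      fun i _ => sin_sq_le_one _
  exact one_div_le_one_div_of_le (by linarith) (by linarith)

theorem cont_bounds (d : ℕ) (hd : 3 ≤ d) :
    1 / (4 * (d : ℝ)) ≤ RaveCont d ∧ RaveCont d ≤ 4 / (d : ℝ) := by
  have hd0 : (0 : ℝ) < d := by exact_mod_cast (by omega : 0 < d)
  set μ : Measure (Fin d → ℝ) :=
    Measure.pi fun _ : Fin d => (volume : Measure ℝ).restrict (Set.Ioo 0 1) with hμ
  have hbox : (volume : Measure (Fin d → ℝ)).restrict
      (Set.univ.pi fun _ : Fin d => Set.Ioo (0 : ℝ) 1) = μ := by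
    rw [hμ, volume_pi, Measure.restrict_pi_pi]
  have hR : RaveCont d = ∫ x, 1 / (2 * (d : ℝ) - 2 * ∑ i, cos (2 * π * x i)) ∂μ := by
    have hae : (Set.univ.pi fun _ : Fin d => Set.Ioo (0 : ℝ) 1) =ᵐ[volume]
        (Set.univ.pi fun _ : Fin d => Set.Icc (0 : ℝ) 1) := by
      rw [volume_pi]
      exact Measure.pi_Ioo_ae_eq_pi_Icc
    rw [RaveCont, ← hbox, Measure.restrict_congr_set hae]
  have hmem : ∀ᵐ x ∂μ, ∀ i, x i ∈ Set.Ioo (0 : ℝ) 1 := by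
    rw [← hbox]
    filter_upwards [ae_restrict_mem (MeasurableSet.univ_pi fun _ => measurableSet_Ioo)] with x hx i
    exact hx i (Set.mem_univ i)
  have hprob : IsProbabilityMeasure ((volume : Measure ℝ).restrict (Set.Ioo 0 1)) :=
    ⟨by simp⟩
  have hmaj : Integrable (fun x : Fin d → ℝ => 1 / (4 * (d : ℝ)) * ∏ i, majorantFactor d (x i)) μ :=
    (Integrable.fintype_prod fun _ => integrableOn_majorantFactor d).const_mul _
  have hint : Integrable
      (fun x : Fin d → ℝ => 1 / (2 * (d : ℝ) - 2 * ∑ i, cos (2 * π * x i))) μ := by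
    refine hmaj.mono' (Measurable.aestronglyMeasurable (by fun_prop)) ?_
    filter_upwards [hmem] with x hx
    rw [norm_of_nonneg (le_trans (by positivity) (le_integrand (by omega) hx))]
    exact integrand_le hd hx
  rw [hR]
  constructor
  · calc 1 / (4 * (d : ℝ)) = ∫ _, 1 / (4 * (d : ℝ)) ∂μ := by simp
      _ ≤ _ := integral_mono_ae (integrable_const _) hint
          (hmem.mono fun x hx => le_integrand (by omega) hx)
  · calc ∫ x, 1 / (2 * (d : ℝ) - 2 * ∑ i, cos (2 * π * x i)) ∂μ
        ≤ ∫ x, 1 / (4 * (d : ℝ)) * ∏ i, majorantFactor d (x i) ∂μ :=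
          integral_mono_ae hint hmaj (hmem.mono fun x hx => integrand_le hd hx)
      _ = 1 / (4 * (d : ℝ)) * (∫ x in Set.Ioo (0 : ℝ) 1, majorantFactor d x) ^ d := by
          rw [integral_const_mul, hμ, integral_fintype_prod_eq_pow, Fintype.card_fin]
      _ ≤ 1 / (4 * (d : ℝ)) * ((5 / 2 : ℝ) ^ (3 / d : ℝ)) ^ d := by
          have := setIntegral_majorantFactor_nonneg hd
          gcongr
          exact setIntegral_majorantFactor_le d
      _ = 1 / (4 * (d : ℝ)) * (5 / 2) ^ 3 := by
          rw [← rpow_natCast, ← rpow_mul (by norm_num), div_mul_cancel₀ _ hd0.ne']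
          norm_num
      _ ≤ 4 / d := by
          rw [one_div_mul_eq_div, div_le_div_iff₀ (by positivity) hd0]
          nlinarith
end

section
/- For every fixed integer d ≥ 3, the average effective resistance of the d-dimensional toroidal grid with side length M satisfies liminf_{M→∞} R_ave(T_{M^d}) ≥ 1/(4d) and limsup_{M→∞} R_ave(T_{M^d}) ≤ 8/(d+1). -/
open Real Finset

/-- Distance from `x` to `0` on the cycle of length `M`. -/
def cycleDist {M : ℕ} (x : Fin M) : ℕ := min (x : ℕ) (M - x)

theorem cycleDist_eq_zero {M : ℕ} (x : Fin M) : cycleDist x = 0 ↔ (x : ℕ) = 0 := by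
  have := x.isLt
  unfold cycleDist
  omega

theorem card_cycleDist_le (M n : ℕ) :
    #{x : Fin M | cycleDist x ≤ n} ≤ 2 * n + 1 := by
  calc #{x : Fin M | cycleDist x ≤ n}
      = #(({x : Fin M | cycleDist x ≤ n} : Finset (Fin M)).map Fin.valEmbedding) :=
        (card_map _).symm
    _ ≤ #(range (n + 1) ∪ Ico (M - n) M) := by
        refine card_le_card fun k hk => ?_
        simp only [mem_map, mem_filter, mem_univ, true_and, Fin.valEmbedding_apply] at hk
        obtain ⟨x, hx, rfl⟩ := hk
        have := x.isLt
        simp only [cycleDist, mem_union, mem_range, mem_Ico] at hx ⊢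
        omega
    _ ≤ 2 * n + 1 := by
        refine (card_union_le _ _).trans ?_
        simp only [card_range, Nat.card_Ico]
        omega

theorem cycleDist_sq_le_cos {M : ℕ} (x : Fin M) :
    16 / (M : ℝ) ^ 2 * (cycleDist x : ℝ) ^ 2 ≤ 2 - 2 * Real.cos (2 * Real.pi * (x : ℕ) / M) := by
  have hx := x.isLt
  have hM : (0 : ℝ) < M := by exact_mod_cast (by omega : 0 < M)
  have hcos : Real.cos (2 * Real.pi * (x : ℕ) / M)
      = Real.cos (2 * Real.pi * (cycleDist x : ℕ) / M) := by
    unfold cycleDist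
    rcases min_choice (x : ℕ) (M - x) with h | h
    · rw [h]
    · rw [h, Nat.cast_sub hx.le, ← Real.cos_two_pi_sub]
      congr 1
      field_simp
  have hle : (cycleDist x : ℝ) ≤ M / 2 := by
    have : 2 * cycleDist x ≤ M := by unfold cycleDist; omega
    have : (2 : ℝ) * cycleDist x ≤ M := by exact_mod_cast this
    linarith
  have hq := Real.cos_le_one_sub_mul_cos_sq (x := 2 * Real.pi * (cycleDist x : ℕ) / M) (by
    rw [abs_of_nonneg (by positivity), div_le_iff₀ hM]
    nlinarith [Real.pi_pos])
  rw [hcos]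
  have : 2 / Real.pi ^ 2 * (2 * Real.pi * (cycleDist x : ℕ) / M) ^ 2
      = 8 / (M : ℝ) ^ 2 * (cycleDist x : ℝ) ^ 2 := by
    have := Real.pi_pos
    field_simp
    ring
  rw [this] at hq
  linear_combination 2 * hq

theorem sum_comp_injective {ι κ α : Type*} [Fintype ι] [DecidableEq ι] [Fintype κ]
    [DecidableEq κ] [Fintype α] (σ : κ → ι) (hσ : Function.Injective σ) (g : (κ → α) → ℝ) :
    ∑ h : ι → α, g (h ∘ σ)
      = (Fintype.card α : ℝ) ^ (Fintype.card ι - Fintype.card κ) * ∑ t, g t := by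
  classical
  let e : κ ⊕ ((Set.range σ)ᶜ : Set ι) ≃ ι :=
    ((Equiv.ofInjective σ hσ).sumCongr (Equiv.refl _)).trans (Equiv.Set.sumCompl (Set.range σ))
  have he : ∀ k, e (Sum.inl k) = σ k := fun k => by simp [e]
  let E : (ι → α) ≃ (κ → α) × (((Set.range σ)ᶜ : Set ι) → α) :=
    (e.symm.arrowCongr (Equiv.refl α)).trans (Equiv.sumArrowEquivProdArrow _ _ _)
  have hE : ∀ h, h ∘ σ = (E h).1 := fun h => by
    ext k
    simp [E, Equiv.sumArrowEquivProdArrow, he]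
  have hcard : Fintype.card ((Set.range σ)ᶜ : Set ι) = Fintype.card ι - Fintype.card κ := by
    have := Fintype.card_congr e
    rw [Fintype.card_sum] at this
    omega
  simp_rw [hE]
  rw [E.sum_comp (fun p => g p.1), Fintype.sum_prod_type]
  simp [hcard, mul_sum]

/-- Supremum norm of a point of the torus. -/
def torusNorm {κ : Type*} [Fintype κ] {M : ℕ} (t : κ → Fin M) : ℕ :=
  univ.sup fun i => cycleDist (t i)

theorem sum_inv_cycleDist_sq_le (M : ℕ) :
    ∑ x : Fin M, (2 * (cycleDist x : ℝ) + 1) ^ 2 * (1 / (cycleDist x : ℝ) ^ 2)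
      ≤ 25 / 4 * (M : ℝ) + 33 / 4 := by
  calc _ ≤ ∑ x : Fin M, ((25 : ℝ) / 4 + if cycleDist x ≤ 1 then 11 / 4 else 0) := by
        refine sum_le_sum fun x _ => ?_
        generalize cycleDist x = n
        rcases n with _ | _ | n
        · norm_num
        · norm_num
        · rw [if_neg (by omega), mul_one_div, add_zero, div_le_iff₀ (by positivity)]
          push_cast
          nlinarith [n.cast_nonneg (α := ℝ)]
    _ ≤ 25 / 4 * (M : ℝ) + 33 / 4 := by
        have : (#{x : Fin M | cycleDist x ≤ 1} : ℝ) ≤ 3 := by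
          exact_mod_cast card_cycleDist_le M 1
        rw [sum_add_distrib, ← sum_filter]
        simp only [sum_const, card_univ, Fintype.card_fin, nsmul_eq_mul]
        linarith

theorem sum_inv_torusNorm_sq_le (M : ℕ) :
    ∑ t : Fin 3 → Fin M, 1 / (torusNorm t : ℝ) ^ 2 ≤ 75 / 4 * (M : ℝ) + 99 / 4 := by
  have hpt : ∀ t : Fin 3 → Fin M, 1 / (torusNorm t : ℝ) ^ 2 ≤
      ∑ i, if ∀ k, cycleDist (t k) ≤ cycleDist (t i) then 1 / (cycleDist (t i) : ℝ) ^ 2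
        else 0 := fun t => by
    obtain ⟨i, -, hi⟩ := exists_mem_eq_sup univ univ_nonempty fun i => cycleDist (t i)
    have hmax : ∀ k, cycleDist (t k) ≤ cycleDist (t i) := fun k =>
      hi ▸ le_sup (f := fun i => cycleDist (t i)) (mem_univ k)
    refine le_trans (le_of_eq ?_) (single_le_sum (fun i _ => ?_) (mem_univ i))
    · rw [if_pos hmax, torusNorm, hi]
    · split_ifs <;> positivity
  have hi : ∀ i : Fin 3, (∑ t : Fin 3 → Fin M,
      if ∀ k, cycleDist (t k) ≤ cycleDist (t i) then 1 / (cycleDist (t i) : ℝ) ^ 2 else 0)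
      ≤ 25 / 4 * (M : ℝ) + 33 / 4 := fun i => by
    rw [← sum_fiberwise univ (fun t => t i)]
    refine le_trans (sum_le_sum fun x _ => ?_) (sum_inv_cycleDist_sq_le M)
    rw [← sum_filter, filter_filter]
    have hsub : ({t | t i = x ∧ ∀ k, cycleDist (t k) ≤ cycleDist (t i)} :
        Finset (Fin 3 → Fin M)) ⊆ Fintype.piFinset fun k =>
          if k = i then {x} else ({y | cycleDist y ≤ cycleDist x} : Finset (Fin M)) := by
      intro t ht
      simp only [mem_filter, mem_univ, true_and] at ht
      refine Fintype.mem_piFinset.2 fun k => ?_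
      split_ifs with hk
      · simp [hk, ht.1]
      · simpa [ht.1] using ht.2 k
    have hcard : #({t | t i = x ∧ ∀ k, cycleDist (t k) ≤ cycleDist (t i)} :
        Finset (Fin 3 → Fin M)) ≤ (2 * cycleDist x + 1) ^ 2 := by
      refine (card_le_card hsub).trans ?_
      rw [Fintype.card_piFinset, ← mul_prod_erase univ _ (mem_univ i), if_pos rfl,
        card_singleton, one_mul]
      calc _ ≤ ∏ k ∈ univ.erase i, (2 * cycleDist x + 1) := by
            refine prod_le_prod' fun k hk => ?_
            rw [if_neg (ne_of_mem_erase hk)]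
            exact card_cycleDist_le M _
        _ = _ := by simp
    calc _ = ∑ t : Fin 3 → Fin M with t i = x ∧ ∀ k, cycleDist (t k) ≤ cycleDist (t i),
          1 / (cycleDist x : ℝ) ^ 2 := by
          refine sum_congr rfl fun t ht => ?_
          rw [(mem_filter.1 ht).2.1]
      _ ≤ _ := by
          rw [sum_const, nsmul_eq_mul]
          gcongr
          exact_mod_cast hcard
  calc _ ≤ _ := sum_le_sum fun t _ => hpt t
    _ ≤ ∑ i : Fin 3, ((25 : ℝ) / 4 * M + 33 / 4) := by
        rw [sum_comm]
        exact sum_le_sum fun i _ => hi i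
    _ = _ := by simp; ring

theorem torusNorm_eq_zero {κ : Type*} [Fintype κ] {M : ℕ} (t : κ → Fin M) :
    torusNorm t = 0 ↔ ∀ i, (t i : ℕ) = 0 := by
  simp [torusNorm, Finset.sup_eq_zero, cycleDist_eq_zero]

theorem sum_torusNorm_eq_zero_le (M : ℕ) :
    (∑ t : Fin 3 → Fin M, if torusNorm t = 0 then (1 : ℝ) else 0) ≤ 1 := by
  rw [sum_boole]
  norm_cast
  refine card_le_one.2 fun a ha b hb => ?_
  simp only [mem_filter, mem_univ, true_and, torusNorm_eq_zero] at ha hb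
  ext i
  rw [ha, hb]

/-- The `j`-th block of three consecutive coordinates. -/
def coordBlock {d : ℕ} (j : Fin (d / 3)) (k : Fin 3) : Fin d :=
  ⟨3 * j + k, by omega⟩

theorem coordBlock_injective {d : ℕ} :
    Function.Injective fun p : Fin (d / 3) × Fin 3 => coordBlock p.1 p.2 := by
  rintro ⟨j, k⟩ ⟨j', k'⟩ h
  simp only [coordBlock, Fin.mk.injEq] at h
  ext <;> simp <;> omega

theorem torusNorm_sq_le {κ : Type*} [Fintype κ] {M : ℕ} (t : κ → Fin M) :
    (torusNorm t : ℝ) ^ 2 ≤ ∑ i, (cycleDist (t i) : ℝ) ^ 2 := by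
  rcases isEmpty_or_nonempty κ with h | h
  · simp [torusNorm]
  · obtain ⟨i, -, hi⟩ := exists_mem_eq_sup univ univ_nonempty fun i => cycleDist (t i)
    rw [torusNorm, hi]
    exact single_le_sum (f := fun i => (cycleDist (t i) : ℝ) ^ 2) (fun i _ => by positivity)
      (mem_univ i)

theorem sum_torusNorm_sq_le {d M : ℕ} (h : Fin d → Fin M) :
    ∑ j : Fin (d / 3), (torusNorm (h ∘ coordBlock j) : ℝ) ^ 2
      ≤ ∑ i, (cycleDist (h i) : ℝ) ^ 2 := by
  calc _ ≤ ∑ j : Fin (d / 3), ∑ k, (cycleDist (h (coordBlock j k)) : ℝ) ^ 2 :=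
        sum_le_sum fun j _ => torusNorm_sq_le _
    _ = ∑ p : Fin (d / 3) × Fin 3, (cycleDist (h (coordBlock p.1 p.2)) : ℝ) ^ 2 :=
        (Fintype.sum_prod_type' fun j k => (cycleDist (h (coordBlock j k)) : ℝ) ^ 2).symm
    _ = ∑ i ∈ univ.map ⟨_, coordBlock_injective⟩, (cycleDist (h i) : ℝ) ^ 2 := by
        rw [sum_map]; rfl
    _ ≤ _ := sum_le_sum_of_subset_of_nonneg (subset_univ _) fun _ _ _ => by positivity

theorem inv_sum_le_sum_inv {ι : Type*} [Fintype ι] [Nonempty ι] (y : ι → ℝ) (hy : ∀ i, 0 < y i) :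
    1 / ∑ i, y i ≤ 1 / (Fintype.card ι : ℝ) ^ 2 * ∑ i, 1 / y i := by
  have h := sq_sum_div_le_sum_sq_div univ (fun _ : ι => (1 : ℝ)) (g := y) (fun i _ => hy i)
  have hpos : 0 < ∑ i, y i := sum_pos (fun i _ => hy i) univ_nonempty
  have hc : (0 : ℝ) < Fintype.card ι := by exact_mod_cast Fintype.card_pos
  simp only [sum_const, card_univ, nsmul_eq_mul, mul_one, one_pow] at h
  calc _ = 1 / (Fintype.card ι : ℝ) ^ 2 * ((Fintype.card ι : ℝ) ^ 2 / ∑ i, y i) := by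
        field_simp
    _ ≤ _ := by gcongr

theorem laplacian_eigenvalue_lower_bound {d M : ℕ} (h : Fin d → Fin M) :
    16 / (M : ℝ) ^ 2 * ∑ i, (cycleDist (h i) : ℝ) ^ 2
      ≤ 2 * d - 2 * ∑ i, Real.cos (2 * Real.pi * (h i : ℕ) / M) := by
  calc _ ≤ ∑ i, (2 - 2 * Real.cos (2 * Real.pi * (h i : ℕ) / M)) := by
        rw [mul_sum]
        exact sum_le_sum fun i _ => cycleDist_sq_le_cos _
    _ = _ := by
        rw [sum_sub_distrib, mul_sum]
        simp [mul_comm]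

theorem one_le_sum_cycleDist_sq {d M : ℕ} (h : Fin d → Fin M) (hh : ¬ ∀ i, (h i : ℕ) = 0) :
    (1 : ℝ) ≤ ∑ i, (cycleDist (h i) : ℝ) ^ 2 := by
  obtain ⟨i, hi⟩ := not_forall.1 hh
  have h1 : 1 ≤ cycleDist (h i) := Nat.one_le_iff_ne_zero.2 (by rwa [Ne, cycleDist_eq_zero])
  calc (1 : ℝ) ≤ (cycleDist (h i) : ℝ) ^ 2 := one_le_pow₀ (by exact_mod_cast h1)
    _ ≤ _ := single_le_sum (f := fun i => (cycleDist (h i) : ℝ) ^ 2)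
        (fun i _ => by positivity) (mem_univ i)

theorem inv_sum_cycleDist_sq_le {d M : ℕ} (hd : 3 ≤ d) (h : Fin d → Fin M)
    (hh : ¬ ∀ i, (h i : ℕ) = 0) :
    1 / ∑ i, (cycleDist (h i) : ℝ) ^ 2
      ≤ 1 / ((d / 3 : ℕ) : ℝ) ^ 2 * ∑ j : Fin (d / 3), 1 / (torusNorm (h ∘ coordBlock j) : ℝ) ^ 2
        + ∑ j : Fin (d / 3), if torusNorm (h ∘ coordBlock j) = 0 then (1 : ℝ) else 0 := by
  have h1 := one_le_sum_cycleDist_sq h hh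
  by_cases h0 : ∃ j : Fin (d / 3), torusNorm (h ∘ coordBlock j) = 0
  · obtain ⟨j, hj⟩ := h0
    have h2 : (1 : ℝ) ≤ ∑ j : Fin (d / 3),
        if torusNorm (h ∘ coordBlock j) = 0 then (1 : ℝ) else 0 := by
      refine le_trans (le_of_eq ?_) (single_le_sum (fun i _ => ?_) (mem_univ j))
      · rw [if_pos hj]
      · split_ifs <;> norm_num
    have h3 : 1 / ∑ i, (cycleDist (h i) : ℝ) ^ 2 ≤ 1 := (div_le_one (by linarith)).2 h1
    have h4 : 0 ≤ 1 / ((d / 3 : ℕ) : ℝ) ^ 2 *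
        ∑ j : Fin (d / 3), 1 / (torusNorm (h ∘ coordBlock j) : ℝ) ^ 2 := by positivity
    linarith
  · push Not at h0
    have : Nonempty (Fin (d / 3)) := ⟨⟨0, by omega⟩⟩
    have hpos : ∀ j : Fin (d / 3), 0 < (torusNorm (h ∘ coordBlock j) : ℝ) ^ 2 := fun j => by
      have := Nat.pos_of_ne_zero (h0 j)
      positivity
    simp only [h0, if_false, sum_const_zero, add_zero]
    have h5 := inv_sum_le_sum_inv _ hpos
    rw [Fintype.card_fin] at h5
    exact (one_div_le_one_div_of_le (sum_pos (fun j _ => hpos j) univ_nonempty)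
      (sum_torusNorm_sq_le h)).trans h5

theorem RaveTorus_le {d M : ℕ} (hd : 3 ≤ d) (hM : 0 < M) :
    RaveTorus d M ≤ 75 / (64 * ((d / 3 : ℕ) : ℝ))
      + (99 / (64 * ((d / 3 : ℕ) : ℝ)) + ((d / 3 : ℕ) : ℝ) / 16) / M := by
  have hm : 0 < d / 3 := by omega
  have hMR : (0 : ℝ) < M := by exact_mod_cast hM
  have hsum : ∀ g : (Fin 3 → Fin M) → ℝ, ∑ h : Fin d → Fin M, ∑ j : Fin (d / 3),
      g (h ∘ coordBlock j) = (d / 3 : ℕ) * ((M : ℝ) ^ (d - 3) * ∑ t, g t) := fun g => by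
    have hinj : ∀ j : Fin (d / 3), Function.Injective (coordBlock j) := fun j k k' hk =>
      (Prod.ext_iff.1 (coordBlock_injective (a₁ := (j, k)) (a₂ := (j, k')) hk)).2
    rw [sum_comm, sum_congr rfl fun j _ => sum_comp_injective _ (hinj j) g]
    simp
  set m := d / 3
  have hmR : (0 : ℝ) < m := by exact_mod_cast hm
  calc RaveTorus d M ≤ 1 / (M : ℝ) ^ d * ∑ h : Fin d → Fin M, (M : ℝ) ^ 2 / 16 *
        (1 / (m : ℝ) ^ 2 * ∑ j : Fin m, 1 / (torusNorm (h ∘ coordBlock j) : ℝ) ^ 2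
          + ∑ j : Fin m, if torusNorm (h ∘ coordBlock j) = 0 then (1 : ℝ) else 0) := by
        unfold RaveTorus
        gcongr with h
        split_ifs with hh
        · have : 0 ≤ ∑ j : Fin m, if torusNorm (h ∘ coordBlock j) = 0 then (1 : ℝ) else 0 :=
            sum_nonneg fun j _ => by split_ifs <;> norm_num
          positivity
        · have hpos := one_le_sum_cycleDist_sq h hh
          calc _ ≤ 1 / (16 / (M : ℝ) ^ 2 * ∑ i, (cycleDist (h i) : ℝ) ^ 2) :=
                one_div_le_one_div_of_le (by positivity) (laplacian_eigenvalue_lower_bound h)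
            _ = (M : ℝ) ^ 2 / 16 * (1 / ∑ i, (cycleDist (h i) : ℝ) ^ 2) := by field_simp
            _ ≤ _ := by
                gcongr
                exact inv_sum_cycleDist_sq_le hd h hh
    _ = 1 / (M : ℝ) ^ d * ((M : ℝ) ^ 2 / 16 * (1 / (m : ℝ) ^ 2 * (m * ((M : ℝ) ^ (d - 3) *
          ∑ t : Fin 3 → Fin M, 1 / (torusNorm t : ℝ) ^ 2)) + m * ((M : ℝ) ^ (d - 3) *
          ∑ t : Fin 3 → Fin M, if torusNorm t = 0 then (1 : ℝ) else 0))) := by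
        rw [← hsum, ← hsum, ← mul_sum, sum_add_distrib, ← mul_sum]
    _ ≤ 1 / (M : ℝ) ^ d * ((M : ℝ) ^ 2 / 16 * (1 / (m : ℝ) ^ 2 * (m * ((M : ℝ) ^ (d - 3) *
          (75 / 4 * M + 99 / 4))) + m * ((M : ℝ) ^ (d - 3) * 1))) := by
        gcongr
        · exact sum_inv_torusNorm_sq_le M
        · exact sum_torusNorm_eq_zero_le M
    _ = _ := by
        obtain ⟨e, he⟩ := Nat.exists_eq_add_of_le hd
        have hde : d - 3 = e := by omega
        have hM3 : (M : ℝ) ^ d = (M : ℝ) ^ e * (M : ℝ) ^ 3 := by rw [he]; ring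
        rw [hde, hM3]
        field_simp
        ring

theorem le_RaveTorus {d M : ℕ} (hd : 0 < d) (hM : 0 < M) :
    1 / (4 * (d : ℝ)) - 1 / (4 * (d : ℝ)) / M ≤ RaveTorus d M := by
  have hMR : (1 : ℝ) ≤ M := by exact_mod_cast hM
  have hdR : (0 : ℝ) < d := by exact_mod_cast hd
  have hpt : ∀ h : Fin d → Fin M,
      1 / (4 * (d : ℝ)) - (if h = fun _ => ⟨0, hM⟩ then 1 / (4 * (d : ℝ)) else 0) ≤
      if ∀ i, (h i : ℕ) = 0 then 0
      else 1 / (2 * d - 2 * ∑ i, Real.cos (2 * Real.pi * (h i : ℕ) / M)) := fun h => by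
    have hiff : (h = fun _ => ⟨0, hM⟩) ↔ ∀ i, (h i : ℕ) = 0 := by
      simp [funext_iff, Fin.ext_iff]
    by_cases hh : ∀ i, (h i : ℕ) = 0
    · rw [if_pos hh, if_pos (hiff.2 hh), sub_self]
    · rw [if_neg hh, if_neg (mt hiff.1 hh), sub_zero]
      have hpos : 0 < 16 / (M : ℝ) ^ 2 * ∑ i, (cycleDist (h i) : ℝ) ^ 2 := by
        have := one_le_sum_cycleDist_sq h hh
        positivity
      refine one_div_le_one_div_of_le (hpos.trans_le (laplacian_eigenvalue_lower_bound h)) ?_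
      have : ∑ i : Fin d, (-1 : ℝ) ≤ ∑ i, Real.cos (2 * Real.pi * (h i : ℕ) / M) :=
        sum_le_sum fun i _ => Real.neg_one_le_cos _
      simp only [sum_const, card_univ, Fintype.card_fin, nsmul_eq_mul] at this
      linarith
  calc _ ≤ 1 / (4 * (d : ℝ)) - 1 / (4 * (d : ℝ)) / (M : ℝ) ^ d := by
        gcongr
        exact le_self_pow₀ hMR hd.ne'
    _ = 1 / (M : ℝ) ^ d * ∑ h : Fin d → Fin M,
        (1 / (4 * (d : ℝ)) - (if h = fun _ => ⟨0, hM⟩ then 1 / (4 * (d : ℝ)) else 0)) := by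
        rw [sum_sub_distrib, sum_ite_eq' univ, if_pos (mem_univ _)]
        simp only [sum_const, card_univ, Fintype.card_fun, Fintype.card_fin, nsmul_eq_mul]
        push_cast
        field_simp
    _ ≤ _ := by
        unfold RaveTorus
        gcongr with h
        exact hpt h

theorem torusd_liminf_limsup (d : ℕ) (hd : 3 ≤ d) :
    1 / (4 * (d : ℝ)) ≤ Filter.liminf (fun M : ℕ => RaveTorus d M) Filter.atTop ∧
    Filter.limsup (fun M : ℕ => RaveTorus d M) Filter.atTop ≤ 8 / ((d : ℝ) + 1) := by
  have hlow : Filter.Tendsto (fun M : ℕ => 1 / (4 * (d : ℝ)) - 1 / (4 * (d : ℝ)) / (M : ℝ))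
      Filter.atTop (nhds (1 / (4 * (d : ℝ)))) := by
    simpa using tendsto_const_nhds.sub (tendsto_const_div_atTop_nhds_zero_nat (1 / (4 * (d : ℝ))))
  have hup : Filter.Tendsto (fun M : ℕ => 75 / (64 * ((d / 3 : ℕ) : ℝ))
      + (99 / (64 * ((d / 3 : ℕ) : ℝ)) + ((d / 3 : ℕ) : ℝ) / 16) / (M : ℝ))
      Filter.atTop (nhds (75 / (64 * ((d / 3 : ℕ) : ℝ)))) := by
    simpa using tendsto_const_nhds.add (tendsto_const_div_atTop_nhds_zero_nat
      (99 / (64 * ((d / 3 : ℕ) : ℝ)) + ((d / 3 : ℕ) : ℝ) / 16))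
  have hle := (Filter.eventually_gt_atTop 0).mono fun M hM => RaveTorus_le (M := M) hd hM
  have hge := (Filter.eventually_gt_atTop 0).mono fun M hM =>
    le_RaveTorus (d := d) (M := M) (by omega) hM
  constructor
  · rw [← hlow.liminf_eq]
    exact Filter.liminf_le_liminf hge hlow.isBoundedUnder_ge
      (hup.isBoundedUnder_le.mono_le hle).isCoboundedUnder_ge
  · calc _ ≤ _ := Filter.limsup_le_limsup hle
          (hlow.isBoundedUnder_ge.mono_ge hge).isCoboundedUnder_le hup.isBoundedUnder_le
      _ = 75 / (64 * ((d / 3 : ℕ) : ℝ)) := hup.limsup_eq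
      _ ≤ 8 / ((d : ℝ) + 1) := by
        have hm : (1 : ℝ) ≤ (d / 3 : ℕ) := by exact_mod_cast (by omega : 1 ≤ d / 3)
        have hdm : (d : ℝ) ≤ 3 * (d / 3 : ℕ) + 2 := by
          exact_mod_cast (by omega : d ≤ 3 * (d / 3) + 2)
        rw [div_le_div_iff₀ (by positivity) (by positivity)]
        linarith
end
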